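/- In the Case A setup (see context), assume additionally that there is no decreasing path (possibly consisting of a single vertex) from a vertex of 𝓥_e to the origin in U⁺, i.e. no path y_0,…,y_s with y_0 ∈ 𝓥_e, y_s = 0 and p ≥ U⁺_{y_0 y_1} > U⁺_{y_1 y_2} > … > U⁺_{y_{s−1} y_s}. Then every good configuration U′ with U′_f ≤ p for all f ∈ 𝓔_e with ω⁺_f = 1 belongs to E_n(p). -/

import Mathlib

open MeasureTheory

namespace CDP

/-- Vertices of the hypercubic lattice `ℤ^d`. -/
abbrev Vertex (d : ℕ) := Fin d → ℤ

/-- Nearest-neighbour adjacency in `ℤ^d`. -/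
def adj {d : ℕ} (x y : Vertex d) : Prop := (∑ i, |x i - y i|) = 1

/-- `e` is a nearest-neighbour (non-oriented) edge of `ℤ^d`, i.e. an element of `𝓔`. -/
def IsNNEdge {d : ℕ} (e : Sym2 (Vertex d)) : Prop := ∃ x y, adj x y ∧ e = s(x, y)

/-- Configurations: labels attached to (unordered) pairs of vertices; only the labels of
nearest-neighbour edges (elements of `𝓔`) are ever relevant. -/
abbrev Config (d : ℕ) := Sym2 (Vertex d) → ℝ

/-- `ℓ^1` norm of a vertex. -/
def norm1 {d : ℕ} (x : Vertex d) : ℤ := ∑ i, |x i|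

/-- The set `Ω`: configurations with values in `[0,1]`, pairwise distinct coordinates on `𝓔`,
and no infinite walk along which the labels are strictly monotone. -/
def goodConfigs (d : ℕ) : Set (Config d) :=
  {U | (∀ e, IsNNEdge e → U e ∈ Set.Icc (0 : ℝ) 1) ∧
    (∀ e f, IsNNEdge e → IsNNEdge f → U e = U f → e = f) ∧
    ¬ ∃ w : ℕ → Vertex d, (∀ i, adj (w i) (w (i + 1))) ∧
      (StrictMono (fun i => U s(w i, w (i + 1))) ∨ StrictAnti (fun i => U s(w i, w (i + 1))))}

/-- A labelling `σ` of the edges by "ever opens" which is consistent with the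
constrained-degree dynamics driven by `U`: an edge (attempting to open at time `U e`)
opens iff at that moment both of its end-vertices have degree `< κ` among the
previously opened edges. -/
def Consistent {d : ℕ} (κ : ℕ) (U : Config d) (σ : Sym2 (Vertex d) → Prop) : Prop :=
  ∀ e, IsNNEdge e →
    (σ e ↔ ∀ v ∈ e,
      Set.ncard {f : Sym2 (Vertex d) | IsNNEdge f ∧ v ∈ f ∧ f ≠ e ∧ U f < U e ∧ σ f} < κ)

/-- `ω_p(U, e) = 1`, i.e. the edge `e` is `p`-open in the constrained-degree percolation
process with constraint `κ` driven by `U`. -/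
def openEdge {d : ℕ} (κ : ℕ) (U : Config d) (p : ℝ) (e : Sym2 (Vertex d)) : Prop :=
  IsNNEdge e ∧ U e ≤ p ∧ ∃ σ, Consistent κ U σ ∧ σ e

/-- `x 0, …, x k` is a path: consecutive vertices adjacent, all vertices distinct. -/
def IsPathOn {d : ℕ} (k : ℕ) (x : ℕ → Vertex d) : Prop :=
  (∀ i < k, adj (x i) (x (i + 1))) ∧ ∀ i ≤ k, ∀ j ≤ k, x i = x j → i = j

/-- The modified one-arm event `E_n(p)`: a path `x_0, …, x_k` with `‖x_0‖₁ = n`,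
`‖x_i‖₁ < n` for `1 ≤ i ≤ k`, `x_k = 0`, whose head consists of `p`-open edges and whose
tail is decreasing (values `≤ p`, strictly decreasing towards the origin). -/
def modifiedOneArm {d : ℕ} (κ n : ℕ) (p : ℝ) (U : Config d) : Prop :=
  ∃ (k : ℕ) (x : ℕ → Vertex d),
    IsPathOn k x ∧ norm1 (x 0) = (n : ℤ) ∧ (∀ i, 1 ≤ i → i ≤ k → norm1 (x i) < (n : ℤ)) ∧
    x k = 0 ∧
    ∃ l ≤ k,
      (∀ i < l, openEdge κ U p s(x i, x (i + 1))) ∧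
      (∀ i, l ≤ i → i < k → U s(x i, x (i + 1)) ≤ p) ∧
      (∀ i, l ≤ i → i + 1 < k → U s(x (i + 1), x (i + 2)) < U s(x i, x (i + 1)))

/-- `a` and `b` are connected by a `p`-open path. -/
def openConn {d : ℕ} (κ : ℕ) (U : Config d) (p : ℝ) (a b : Vertex d) : Prop :=
  ∃ (k : ℕ) (x : ℕ → Vertex d), IsPathOn k x ∧ x 0 = a ∧ x k = b ∧
    ∀ i < k, openEdge κ U p s(x i, x (i + 1))

/-- There is an infinite `p`-open path starting at the origin. -/
def zeroToInf {d : ℕ} (κ : ℕ) (U : Config d) (p : ℝ) : Prop :=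
  ∃ x : ℕ → Vertex d, x 0 = 0 ∧ (∀ i, adj (x i) (x (i + 1))) ∧ Function.Injective x ∧
    ∀ i, openEdge κ U p s(x i, x (i + 1))

/-- `P` is the law of i.i.d. `Uniform[0,1]` labels: a probability measure whose
finite-dimensional cylinder probabilities are products of uniform probabilities. -/
def IsProductUniform {d : ℕ} (P : Measure (Config d)) : Prop :=
  IsProbabilityMeasure P ∧
    ∀ (s : Finset (Sym2 (Vertex d))) (f : Sym2 (Vertex d) → Set ℝ),
      (∀ e ∈ s, MeasurableSet (f e)) →
      P {U | ∀ e ∈ s, U e ∈ f e} = ∏ e ∈ s, volume (f e ∩ Set.Icc 0 1)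

/-- The one-arm probability `θ_n(p)`. -/
noncomputable def theta {d : ℕ} (κ : ℕ) (P : Measure (Config d)) (n : ℕ) (p : ℝ) : ℝ :=
  (P {U | U ∈ goodConfigs d ∧ ∃ b, norm1 b = (n : ℤ) ∧ openConn κ U p 0 b}).toReal

/-- `θ(p) = ℙ(0 ↔ ∞)`. -/
noncomputable def thetaInf {d : ℕ} (κ : ℕ) (P : Measure (Config d)) (p : ℝ) : ℝ :=
  (P {U | U ∈ goodConfigs d ∧ zeroToInf κ U p}).toReal

/-- The critical point `p_c`. -/
noncomputable def pc {d : ℕ} (κ : ℕ) (P : Measure (Config d)) : ℝ :=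
  sSup {p : ℝ | p ∈ Set.Icc (0 : ℝ) 1 ∧ thetaInf κ P p = 0}

/-- The modified one-arm probability `τ_n(p)`. -/
noncomputable def tau {d : ℕ} (κ : ℕ) (P : Measure (Config d)) (n : ℕ) (p : ℝ) : ℝ :=
  (P {U | U ∈ goodConfigs d ∧ modifiedOneArm κ n p U}).toReal

/-- `e` is `p`-pivotal for `E_n(p)` at `U`. -/
def pPivotal {d : ℕ} (κ n : ℕ) (p : ℝ) (e : Sym2 (Vertex d)) (U : Config d) : Prop :=
  U ∈ goodConfigs d ∧ p < U e ∧ Function.update U e p ∈ goodConfigs d ∧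
    ¬ (modifiedOneArm κ n p U ↔ modifiedOneArm κ n p (Function.update U e p))

/-- `e` is `U`-pivotal for `E_n(p)` at `U`. -/
def uPivotal {d : ℕ} (κ n : ℕ) (p : ℝ) (e : Sym2 (Vertex d)) (U : Config d) : Prop :=
  U ∈ goodConfigs d ∧ ∃ U' ∈ goodConfigs d, (∀ f, f ≠ e → U' f = U f) ∧
    ¬ (modifiedOneArm κ n p U ↔ modifiedOneArm κ n p U')


/-- The edge set `𝓔_e` of the switching path of `e`: edges where `ω_p(U^{e+})` and
`ω_p(U^{e−})` differ. -/
def switchEdges {d : ℕ} (κ : ℕ) (U : Config d) (p : ℝ) (e : Sym2 (Vertex d)) :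
    Set (Sym2 (Vertex d)) :=
  {f | IsNNEdge f ∧
    ¬ (openEdge κ (Function.update U e 0) p f ↔ openEdge κ (Function.update U e 1) p f)}

/-- The vertex set `𝓥_e` of the switching path of `e`. -/
def switchVerts {d : ℕ} (κ : ℕ) (U : Config d) (p : ℝ) (e : Sym2 (Vertex d)) :
    Set (Vertex d) :=
  {v | ∃ f ∈ switchEdges κ U p e, v ∈ f}

/-- A *good* configuration (Case A): `U'_f > p` for every edge `f` meeting `𝓥_e` with
`ω⁺_f = 0`, and `U'_f = U_f` for every remaining edge `f ∈ 𝓔 \ 𝓔_e`. -/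
def GoodCfg {d : ℕ} (κ : ℕ) (U Uplus : Config d) (p : ℝ) (e : Sym2 (Vertex d))
    (U' : Config d) : Prop :=
  U' ∈ goodConfigs d ∧
    (∀ f, IsNNEdge f → (∃ v ∈ switchVerts κ U p e, v ∈ f) → ¬ openEdge κ Uplus p f →
      p < U' f) ∧
    (∀ f, IsNNEdge f → f ∉ switchEdges κ U p e →
      ¬ ((∃ v ∈ switchVerts κ U p e, v ∈ f) ∧ ¬ openEdge κ Uplus p f) → U' f = U f)

lemma adj_comm {d : ℕ} {x y : Vertex d} : adj x y ↔ adj y x := by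
  simp only [adj, abs_sub_comm]

lemma IsNNEdge.exists_eq_of_mem {d : ℕ} {f : Sym2 (Vertex d)} (hf : IsNNEdge f) {v : Vertex d}
    (hv : v ∈ f) : ∃ u, adj v u ∧ f = s(v, u) := by
  obtain ⟨x, y, hxy, rfl⟩ := hf
  rcases Sym2.mem_iff.1 hv with rfl | rfl
  · exact ⟨y, hxy, rfl⟩
  · exact ⟨x, adj_comm.1 hxy, Sym2.eq_swap⟩

lemma finite_edges_at {d : ℕ} (v : Vertex d) :
    {f : Sym2 (Vertex d) | IsNNEdge f ∧ v ∈ f}.Finite := by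
  refine ((Set.finite_Icc (v - 1) (v + 1)).image fun y => s(v, y)).subset ?_
  rintro f ⟨hf, hv⟩
  obtain ⟨u, hu, rfl⟩ := hf.exists_eq_of_mem hv
  refine ⟨u, ?_, rfl⟩
  have hi : ∀ i, |v i - u i| ≤ 1 := fun i =>
    (Finset.single_le_sum (f := fun i => |v i - u i|) (fun _ _ => abs_nonneg _)
      (Finset.mem_univ i)).trans (le_of_eq hu)
  constructor <;> intro i <;> have := abs_le.1 (hi i) <;> simp <;> omega

/-- There is no infinite walk with strictly decreasing labels. -/
def NoDecreasingWalk {d : ℕ} (U : Config d) : Prop :=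
  ¬ ∃ w : ℕ → Vertex d, (∀ i, adj (w i) (w (i + 1))) ∧
    StrictAnti (fun i => U s(w i, w (i + 1)))

lemma noDecreasingWalk_of_mem_goodConfigs {d : ℕ} {U : Config d} (hU : U ∈ goodConfigs d) :
    NoDecreasingWalk U :=
  fun ⟨w, hw, hanti⟩ => hU.2.2 ⟨w, hw, Or.inr hanti⟩

lemma NoDecreasingWalk.update {d : ℕ} {U : Config d} (hU : NoDecreasingWalk U)
    (e : Sym2 (Vertex d)) (t : ℝ) : NoDecreasingWalk (Function.update U e t) := by
  rintro ⟨w, hw, hanti⟩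
  obtain ⟨N, hN⟩ : ∃ N, ∀ i, s(w (i + N), w (i + N + 1)) ≠ e := by
    by_cases h : ∃ N, s(w N, w (N + 1)) = e
    · obtain ⟨N, hN⟩ := h
      refine ⟨N + 1, fun i hi => ?_⟩
      have := hanti (show N < i + (N + 1) by omega)
      simp only [hi, hN, lt_irrefl] at this
    · push Not at h
      exact ⟨0, fun i => h _⟩
  refine hU ⟨fun i => w (i + N), fun i => ?_, fun i j hij => ?_⟩
  · simpa [Nat.add_right_comm] using hw (i + N)
  · have := hanti (show i + N < j + N by omega)
    simpa [Function.update_of_ne (hN _), Nat.add_right_comm _ 1 N] using this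

/-- `g` shares a vertex with `f` and attempts to open before `f`. -/
def Earlier {d : ℕ} (U : Config d) (g f : Sym2 (Vertex d)) : Prop :=
  IsNNEdge g ∧ IsNNEdge f ∧ U g < U f ∧ ∃ v, v ∈ g ∧ v ∈ f

lemma NoDecreasingWalk.wellFounded_earlier {d : ℕ} {U : Config d} (hU : NoDecreasingWalk U) :
    WellFounded (Earlier U) := by
  by_contra hwf
  obtain ⟨f₀, hf₀⟩ : ∃ f, ¬ Acc (Earlier U) f := by
    by_contra! h
    exact hwf ⟨h⟩
  let B : Vertex d × Vertex d → Prop := fun q => adj q.1 q.2 ∧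
    ∃ g, IsNNEdge g ∧ q.2 ∈ g ∧ ¬ Acc (Earlier U) g ∧ U g < U s(q.1, q.2)
  have step : ∀ q : {q // B q}, ∃ q' : {q // B q}, q'.1.1 = q.1.2 ∧
      U s(q'.1.1, q'.1.2) < U s(q.1.1, q.1.2) := by
    rintro ⟨⟨a, b⟩, hab, g, hg, hbg, hgacc, hlt⟩
    obtain ⟨m, ⟨hm, hbm, hmacc⟩, hmin⟩ := Set.exists_min_image
      {g | IsNNEdge g ∧ b ∈ g ∧ ¬ Acc (Earlier U) g} U
      ((finite_edges_at b).subset fun g hg => ⟨hg.1, hg.2.1⟩) ⟨g, hg, hbg, hgacc⟩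
    have hmg := hmin g ⟨hg, hbg, hgacc⟩
    obtain ⟨c, hbc, rfl⟩ := hm.exists_eq_of_mem hbm
    obtain ⟨h, hhacc, hh, -, hhm, v, hvh, hvm⟩ := exists_not_acc_lt_of_not_acc hmacc
    rcases Sym2.mem_iff.1 hvm with rfl | rfl
    · exact absurd (hmin h ⟨hh, hvh, hhacc⟩) (not_le.2 hhm)
    · exact ⟨⟨(b, v), hbc, h, hh, hvh, hhacc, hhm⟩, rfl, hmg.trans_lt hlt⟩
  obtain ⟨q₀⟩ : Nonempty {q // B q} := by
    obtain ⟨g, hgacc, hg, hf, hlt, v, hvg, hvf⟩ := exists_not_acc_lt_of_not_acc hf₀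
    obtain ⟨u, hvu, rfl⟩ := hf.exists_eq_of_mem hvf
    exact ⟨⟨(u, v), adj_comm.1 hvu, g, hg, hvg, hgacc, by rwa [Sym2.eq_swap]⟩⟩
  choose next hnext using step
  let q : ℕ → {q // B q} := fun i => next^[i] q₀
  have hq : ∀ i, q (i + 1) = next (q i) := fun i => Function.iterate_succ_apply' _ _ _
  have hq2 : ∀ i, (q (i + 1)).1.1 = (q i).1.2 := fun i => by rw [hq]; exact (hnext _).1
  refine hU ⟨fun i => (q i).1.1, fun i => ?_, strictAnti_nat_of_succ_lt fun i => ?_⟩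
  · simp only [hq2]
    exact (q i).2.1
  · simp only [hq2]
    have := (hnext (q i)).2
    rwa [← hq, hq2] at this

lemma exists_consistent {d : ℕ} (κ : ℕ) {U : Config d} (hwf : WellFounded (Earlier U)) :
    ∃ σ, Consistent κ U σ := by
  let F : (f : Sym2 (Vertex d)) → ((g : Sym2 (Vertex d)) → Earlier U g f → Prop) → Prop :=
    fun f ih => ∀ v ∈ f, Set.ncard {g | v ∈ g ∧ ∃ h : Earlier U g f, ih g h} < κ
  refine ⟨hwf.fix F, fun f hf => ?_⟩
  rw [hwf.fix_eq F f]
  refine forall₂_congr fun v hv => ?_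
  suffices h : {g | v ∈ g ∧ ∃ _ : Earlier U g f, hwf.fix F g} =
      {g | IsNNEdge g ∧ v ∈ g ∧ g ≠ f ∧ U g < U f ∧ hwf.fix F g} by rw [h]
  ext g
  constructor
  · rintro ⟨hvg, hgf, hg⟩
    exact ⟨hgf.1, hvg, fun h => (h ▸ hgf.2.2.1).ne rfl, hgf.2.2.1, hg⟩
  · rintro ⟨hg, hvg, -, hlt, hσ⟩
    exact ⟨hvg, ⟨hg, hf, hlt, v, hvg, hv⟩, hσ⟩

lemma Consistent.iff_of_wellFounded {d κ : ℕ} {U : Config d} (hwf : WellFounded (Earlier U))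
    {σ τ : Sym2 (Vertex d) → Prop} (hσ : Consistent κ U σ) (hτ : Consistent κ U τ)
    (f : Sym2 (Vertex d)) (hf : IsNNEdge f) : σ f ↔ τ f := by
  induction f using hwf.induction with
  | _ f ih =>
    rw [hσ f hf, hτ f hf]
    refine forall₂_congr fun v hv => ?_
    suffices h : {g | IsNNEdge g ∧ v ∈ g ∧ g ≠ f ∧ U g < U f ∧ σ g} =
        {g | IsNNEdge g ∧ v ∈ g ∧ g ≠ f ∧ U g < U f ∧ τ g} by rw [h]
    ext g
    refine and_congr_right fun hg => and_congr_right fun hvg => and_congr_right fun _ =>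
      and_congr_right fun hlt => ih g ⟨hg, hf, hlt, v, hvg, hv⟩ hg

lemma openEdge_iff {d : ℕ} (κ : ℕ) {U : Config d} (hwf : WellFounded (Earlier U)) (p : ℝ)
    (f : Sym2 (Vertex d)) :
    openEdge κ U p f ↔ IsNNEdge f ∧ U f ≤ p ∧
      ∀ v ∈ f, Set.ncard {g | openEdge κ U p g ∧ v ∈ g ∧ g ≠ f ∧ U g < U f} < κ := by
  obtain ⟨σ, hσ⟩ := exists_consistent κ hwf
  have key : ∀ g, openEdge κ U p g ↔ IsNNEdge g ∧ U g ≤ p ∧ σ g := fun g =>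
    and_congr_right fun hg => and_congr_right fun _ =>
      ⟨fun ⟨_, hτ, hτg⟩ => (hτ.iff_of_wellFounded hwf hσ g hg).1 hτg, fun h => ⟨σ, hσ, h⟩⟩
  rw [key f]
  refine and_congr_right fun hf => and_congr_right fun hfp => ?_
  rw [hσ f hf]
  refine forall₂_congr fun v _ => ?_
  suffices h : {g | IsNNEdge g ∧ v ∈ g ∧ g ≠ f ∧ U g < U f ∧ σ g} =
      {g | openEdge κ U p g ∧ v ∈ g ∧ g ≠ f ∧ U g < U f} by rw [h]
  ext g
  simp only [Set.mem_ofPred_eq, key]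
  constructor
  · rintro ⟨hg, hvg, hne, hlt, hσg⟩
    exact ⟨⟨hg, hlt.le.trans hfp, hσg⟩, hvg, hne, hlt⟩
  · rintro ⟨⟨hg, -, hσg⟩, hvg, hne, hlt⟩
    exact ⟨hg, hvg, hne, hlt, hσg⟩

lemma ncard_open_edges_ne_lt {d κ : ℕ} {U : Config d} (hU : U ∈ goodConfigs d) {p : ℝ}
    {f : Sym2 (Vertex d)} (hf : openEdge κ U p f) {v : Vertex d} (hv : v ∈ f) :
    Set.ncard {g | openEdge κ U p g ∧ v ∈ g ∧ g ≠ f} < κ := by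
  have hwf := (noDecreasingWalk_of_mem_goodConfigs hU).wellFounded_earlier
  set S : Set (Sym2 (Vertex d)) := {g | openEdge κ U p g ∧ v ∈ g} with hS
  have hfin : S.Finite := (finite_edges_at v).subset fun g hg => ⟨hg.1.1, hg.2⟩
  obtain ⟨m, hm, hmax⟩ := Set.exists_max_image S U hfin ⟨f, hf, hv⟩
  have hlt := ((openEdge_iff κ hwf p m).1 hm.1).2.2 v hm.2
  have hSm : {g | openEdge κ U p g ∧ v ∈ g ∧ g ≠ m ∧ U g < U m} = S \ {m} := by
    ext g
    constructor
    · rintro ⟨hg, hvg, hne, -⟩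
      exact ⟨⟨hg, hvg⟩, hne⟩
    · rintro ⟨hg, hne⟩
      exact ⟨hg.1, hg.2, hne, (hmax g hg).lt_of_ne fun h => hne (hU.2.1 g m hg.1.1 hm.1.1 h)⟩
  have hSf : {g | openEdge κ U p g ∧ v ∈ g ∧ g ≠ f} = S \ {f} := by
    ext g
    exact and_assoc.symm
  rw [hSm, Set.ncard_sdiff_singleton_of_mem hm] at hlt
  rwa [hSf, Set.ncard_sdiff_singleton_of_mem (show f ∈ S from ⟨hf, hv⟩)]

lemma mem_switchEdges_self {d κ : ℕ} (hκ : 0 < κ) {p : ℝ} (hp : p ∈ Set.Ico (0 : ℝ) 1)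
    {U : Config d} (hU : U ∈ goodConfigs d) {e : Sym2 (Vertex d)} (he : IsNNEdge e) :
    e ∈ switchEdges κ U p e := by
  have hwf := ((noDecreasingWalk_of_mem_goodConfigs hU).update e 0).wellFounded_earlier
  refine ⟨he, fun h => ?_⟩
  have hopen : openEdge κ (Function.update U e 0) p e := by
    refine (openEdge_iff κ hwf p e).2 ⟨he, by simpa using hp.1, fun v _ => ?_⟩
    suffices hempty : {g | openEdge κ (Function.update U e 0) p g ∧ v ∈ g ∧ g ≠ e ∧
        Function.update U e 0 g < Function.update U e 0 e} = ∅ by rwa [hempty, Set.ncard_empty]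
    refine Set.eq_empty_of_forall_notMem ?_
    rintro g ⟨hg, -, hne, hlt⟩
    rw [Function.update_self, Function.update_of_ne hne] at hlt
    exact absurd (hU.1 g hg.1).1 (not_le.2 hlt)
  have := (h.1 hopen).2.1
  rw [Function.update_self] at this
  exact absurd hp.2 (not_lt.2 this)

/-- A good configuration in which the edges of the switching path that are open in `Uplus` have
labels at most `p` has the same `p`-open edges as `Uplus`. -/
lemma GoodCfg.openEdge_iff {d κ : ℕ} {p : ℝ} {U Uplus U' : Config d} {e : Sym2 (Vertex d)}
    (hgood : GoodCfg κ U Uplus p e U') (he : e ∈ switchEdges κ U p e)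
    (hUp : Uplus ∈ goodConfigs d) (hUpa : ∀ f, f ≠ e → Uplus f = U f)
    (hlep : ∀ f ∈ switchEdges κ U p e, openEdge κ Uplus p f → U' f ≤ p)
    (f : Sym2 (Vertex d)) : openEdge κ U' p f ↔ openEdge κ Uplus p f := by
  obtain ⟨hU', hclosed, hsame⟩ := hgood
  have hwf := (noDecreasingWalk_of_mem_goodConfigs hUp).wellFounded_earlier
  have hwf' := (noDecreasingWalk_of_mem_goodConfigs hU').wellFounded_earlier
  have hagree : ∀ g, IsNNEdge g → g ∉ switchEdges κ U p e →
      ¬ ((∃ v ∈ switchVerts κ U p e, v ∈ g) ∧ ¬ openEdge κ Uplus p g) → U' g = Uplus g :=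
    fun g hg hgs h => (hsame g hg hgs h).trans (hUpa g fun hge => hgs (hge ▸ he)).symm
  have hopen_of_le : ∀ g v, IsNNEdge g → v ∈ g → v ∈ switchVerts κ U p e → U' g ≤ p →
      openEdge κ Uplus p g := fun g v hg hvg hv hle =>
    by_contra fun h => absurd (hclosed g hg ⟨v, hv, hvg⟩ h) (not_lt.2 hle)
  induction f using hwf'.induction with
  | _ f ih =>
    have hcount : ∀ v ∈ f, IsNNEdge f → v ∉ switchVerts κ U p e → U' f = Uplus f →
        {g | openEdge κ U' p g ∧ v ∈ g ∧ g ≠ f ∧ U' g < U' f} =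
          {g | openEdge κ Uplus p g ∧ v ∈ g ∧ g ≠ f ∧ Uplus g < Uplus f} := by
      intro v hvf hf hv hfeq
      have hns : ∀ g, v ∈ g → g ∉ switchEdges κ U p e := fun g hvg hg => hv ⟨g, hg, hvg⟩
      ext g
      constructor
      · rintro ⟨hg, hvg, hne, hlt⟩
        have hgp := (ih g ⟨hg.1, hf, hlt, v, hvg, hvf⟩).1 hg
        have hgeq := hagree g hg.1 (hns g hvg) fun h => h.2 hgp
        exact ⟨hgp, hvg, hne, by rwa [← hgeq, ← hfeq]⟩
      · rintro ⟨hg, hvg, hne, hlt⟩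
        have hgeq := hagree g hg.1 (hns g hvg) fun h => h.2 hg
        rw [← hgeq, ← hfeq] at hlt
        exact ⟨(ih g ⟨hg.1, hf, hlt, v, hvg, hvf⟩).2 hg, hvg, hne, hlt⟩
    constructor
    · intro hf
      by_cases hmeet : ∃ v ∈ switchVerts κ U p e, v ∈ f
      · obtain ⟨v, hv, hvf⟩ := hmeet
        exact hopen_of_le f v hf.1 hvf hv hf.2.1
      · have hfeq := hagree f hf.1
          (fun hfs => by
            obtain ⟨x, y, -, rfl⟩ := hf.1
            exact hmeet ⟨x, ⟨_, hfs, Sym2.mem_mk_left x y⟩, Sym2.mem_mk_left x y⟩)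
          fun h => hmeet h.1
        refine (CDP.openEdge_iff κ hwf p f).2 ⟨hf.1, hfeq ▸ hf.2.1, fun v hvf => ?_⟩
        rw [← hcount v hvf hf.1 (fun hv => hmeet ⟨v, hv, hvf⟩) hfeq]
        exact ((CDP.openEdge_iff κ hwf' p f).1 hf).2.2 v hvf
    · intro hf
      have hfeq : f ∉ switchEdges κ U p e → U' f = Uplus f := fun hfs =>
        hagree f hf.1 hfs fun h => h.2 hf
      have hle : U' f ≤ p := by
        by_cases hfs : f ∈ switchEdges κ U p e
        · exact hlep f hfs hf
        · exact (hfeq hfs).trans_le hf.2.1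
      refine (CDP.openEdge_iff κ hwf' p f).2 ⟨hf.1, hle, fun v hvf => ?_⟩
      by_cases hv : v ∈ switchVerts κ U p e
      · refine lt_of_le_of_lt (Set.ncard_le_ncard ?_ ?_) (ncard_open_edges_ne_lt hUp hf hvf)
        · rintro g ⟨hg, hvg, hne, -⟩
          exact ⟨hopen_of_le g v hg.1 hvg hv hg.2.1, hvg, hne⟩
        · exact (finite_edges_at v).subset fun g hg => ⟨hg.1.1, hg.2.1⟩
      · rw [hcount v hvf hf.1 hv (hfeq fun hfs => hv ⟨f, hfs, hvf⟩)]
        exact ((CDP.openEdge_iff κ hwf p f).1 hf).2.2 v hvf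

/-- **Claim 3 (Case A)**: if there is no decreasing path (possibly a single vertex) from
`𝓥_e` to the origin in `U⁺`, then every good configuration `U'` with `U'_f ≤ p` for all
`f ∈ 𝓔_e` with `ω⁺_f = 1` belongs to `E_n(p)`. -/
theorem good_config_occurs (d κ n : ℕ) (hd : 2 ≤ d) (hκ₁ : 2 ≤ κ) (hκ₂ : κ ≤ 2 * d)
    (hn : 1 ≤ n) (p : ℝ) (hp : p ∈ Set.Ioo (0 : ℝ) 1)
    (U : Config d) (hU : U ∈ goodConfigs d)
    (hU01 : ∀ f, IsNNEdge f → U f ∈ Set.Ioo (0 : ℝ) 1)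
    (e : Sym2 (Vertex d)) (he : IsNNEdge e) (hpiv : uPivotal κ n p e U)
    (Uplus Uminus : Config d)
    (hUp : Uplus ∈ goodConfigs d) (hUpa : ∀ f, f ≠ e → Uplus f = U f)
    (hUpE : modifiedOneArm κ n p Uplus)
    (hUm : Uminus ∈ goodConfigs d) (hUma : ∀ f, f ≠ e → Uminus f = U f)
    (hUmE : ¬ modifiedOneArm κ n p Uminus)
    (hnodec : ¬ ∃ (s : ℕ) (y : ℕ → Vertex d), IsPathOn s y ∧
      y 0 ∈ switchVerts κ U p e ∧ y s = 0 ∧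
      (∀ i < s, Uplus s(y i, y (i + 1)) ≤ p) ∧
      (∀ i, i + 1 < s → Uplus s(y (i + 1), y (i + 2)) < Uplus s(y i, y (i + 1))))
    (U' : Config d) (hgood : GoodCfg κ U Uplus p e U')
    (hlep : ∀ f ∈ switchEdges κ U p e, openEdge κ Uplus p f → U' f ≤ p) :
    modifiedOneArm κ n p U' := by
  have hes : e ∈ switchEdges κ U p e :=
    mem_switchEdges_self (by omega) ⟨hp.1.le, hp.2⟩ hU he
  obtain ⟨k, x, hpath, hx0, hxn, hxk, l, hlk, hhead, hle, hdec⟩ := hUpE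
  have havoid : ∀ i, l ≤ i → i ≤ k → x i ∉ switchVerts κ U p e := by
    intro i hli hik hi
    refine hnodec ⟨k - i, fun j => x (i + j), ⟨fun j hj => hpath.1 (i + j) (by omega),
      fun a ha b hb hab => ?_⟩, hi, ?_, fun j hj => hle (i + j) (by omega) (by omega),
      fun j hj => hdec (i + j) (by omega) (by omega)⟩
    · have := hpath.2 (i + a) (by omega) (i + b) (by omega) hab
      omega
    · simpa [Nat.add_sub_cancel' hik] using hxk
  have htail : ∀ i, l ≤ i → i < k → U' s(x i, x (i + 1)) = Uplus s(x i, x (i + 1)) := by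
    intro i hli hik
    have hns : s(x i, x (i + 1)) ∉ switchEdges κ U p e := fun h =>
      havoid i hli hik.le ⟨_, h, Sym2.mem_mk_left _ _⟩
    rw [hUpa _ fun h => hns (by rwa [h])]
    refine hgood.2.2 _ ⟨_, _, hpath.1 i hik, rfl⟩ hns ?_
    rintro ⟨⟨v, hv, hvm⟩, -⟩
    rcases Sym2.mem_iff.1 hvm with rfl | rfl
    · exact havoid i hli hik.le hv
    · exact havoid (i + 1) (by omega) hik hv
  refine ⟨k, x, hpath, hx0, hxn, hxk, l, hlk, fun i hi => ?_, fun i hli hik => ?_,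
    fun i hli hik => ?_⟩
  · exact (hgood.openEdge_iff hes hUp hUpa hlep _).2 (hhead i hi)
  · exact (htail i hli hik).trans_le (hle i hli hik)
  · rw [htail i hli (by omega), htail (i + 1) (by omega) hik]
    exact hdec i hli hik

end CDP
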